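/- Let C₄ be a cyclic group of order 4 with generator g, and let W[C₄/C₂]₋ denote the representation of C₄ on W ⊕ W in which g acts by (a, b) ↦ (−b, a). Then H⁰(C₄, W[C₄/C₂]₋) = 0, H^s(C₄, W[C₄/C₂]₋) = 0 for every even s > 0, and H^s(C₄, W[C₄/C₂]₋) ≅ W/2W for every odd s. -/

import Mathlib

/- Setup: `k` a perfect field of characteristic 2 and `𝕎 = W(k)` the ring of
2-typical Witt vectors of `k`.  Group cohomology is Mathlib's
`groupCohomology`. -/

noncomputable section

instance : Fact (Nat.Prime 2) := ⟨Nat.prime_two⟩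

variable (k : Type) [Field k] [CharP k 2] [PerfectField k]

local notation "𝕎" => WittVector 2 k

lemma aux_gen : ∀ x : Multiplicative (ZMod 4),
    x ∈ Subgroup.zpowers (Multiplicative.ofAdd (1 : ZMod 4)) := by
  intro x
  refine ⟨((x.toAdd).val : ℤ), ?_⟩
  revert x
  decide

lemma aux_two (a : 𝕎) (h : a + a = 0) : a = 0 := by
  have h2 : (2 : 𝕎) ≠ 0 := by
    have := WittVector.p_nonzero 2 k
    exact_mod_cast this
  have h3 : (2 : 𝕎) * a = 0 := by rw [two_mul, h]
  exact (mul_eq_zero.1 h3).resolve_left h2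

lemma aux_ker (ρ : Representation 𝕎 (Multiplicative (ZMod 4)) (𝕎 × 𝕎))
    (hρ : ∀ x : 𝕎 × 𝕎, ρ (Multiplicative.ofAdd (1 : ZMod 4)) x = (-x.2, x.1))
    (x : 𝕎 × 𝕎) (hx : ρ (Multiplicative.ofAdd (1 : ZMod 4)) x = x) : x = 0 := by
  rw [hρ] at hx
  obtain ⟨a, b⟩ := x
  simp only [Prod.mk.injEq] at hx
  obtain ⟨h1, h2⟩ := hx
  subst h2
  have : a = 0 := aux_two k a (by nth_rewrite 1 [← h1]; simp)
  simp [this]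

lemma aux_norm (ρ : Representation 𝕎 (Multiplicative (ZMod 4)) (𝕎 × 𝕎))
    (hρ : ∀ x : 𝕎 × 𝕎, ρ (Multiplicative.ofAdd (1 : ZMod 4)) x = (-x.2, x.1))
    (x : 𝕎 × 𝕎) : ρ.norm x = 0 := by
  refine aux_ker k ρ hρ _ ?_
  simp

/-- The sum map to `W/2W`. -/
def auxMap : (𝕎 × 𝕎) →ₗ[𝕎] (𝕎 ⧸ Ideal.span {(2 : 𝕎)}) :=
  (Submodule.mkQ (Ideal.span {(2 : 𝕎)})) ∘ₗ (LinearMap.fst 𝕎 𝕎 𝕎 + LinearMap.snd 𝕎 𝕎 𝕎)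

lemma auxMap_eq_zero (ρ : Representation 𝕎 (Multiplicative (ZMod 4)) (𝕎 × 𝕎))
    (hρ : ∀ x : 𝕎 × 𝕎, ρ (Multiplicative.ofAdd (1 : ZMod 4)) x = (-x.2, x.1))
    (x : 𝕎 × 𝕎) : auxMap k x = 0 ↔
      ∃ y, ρ (Multiplicative.ofAdd (1 : ZMod 4)) y - y = x := by
  have : auxMap k x = 0 ↔ (2 : 𝕎) ∣ x.1 + x.2 := by
    rw [← Ideal.mem_span_singleton]
    exact Submodule.Quotient.mk_eq_zero _
  rw [this]
  constructor
  · rintro ⟨c, hc⟩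
    refine ⟨(c - x.1, -c), ?_⟩
    rw [hρ]
    ext1
    · simp
    · simp only [Prod.snd_sub]
      linear_combination -hc
  · rintro ⟨y, rfl⟩
    rw [hρ]
    refine ⟨-y.2, ?_⟩
    simp only [Prod.snd_sub, Prod.fst_sub]
    ring

lemma auxMap_surj : Function.Surjective (auxMap k) := by
  intro q
  obtain ⟨a, rfl⟩ := Submodule.Quotient.mk_surjective _ q
  refine ⟨(a, 0), ?_⟩
  simp [auxMap]

/-- Let `C₄` be cyclic of order 4 with generator `g`, and let
`W[C₄/C₂]₋` be the representation of `C₄` on `W ⊕ W` in which `g` acts by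
`(a, b) ↦ (−b, a)`.  Then `H⁰(C₄, W[C₄/C₂]₋) = 0`, `H^s(C₄, W[C₄/C₂]₋) = 0`
for even `s > 0`, and `H^s(C₄, W[C₄/C₂]₋) ≅ W/2W` for odd `s`. -/
theorem statement16
    (ρ : Representation 𝕎 (Multiplicative (ZMod 4)) (𝕎 × 𝕎))
    (hρ : ∀ x : 𝕎 × 𝕎, ρ (Multiplicative.ofAdd (1 : ZMod 4)) x = (-x.2, x.1)) :
    Subsingleton (groupCohomology (Rep.of ρ) 0) ∧
    (∀ s : ℕ, 0 < s → Even s → Subsingleton (groupCohomology (Rep.of ρ) s)) ∧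
    (∀ s : ℕ, Odd s →
      Nonempty ((groupCohomology (Rep.of ρ) s) ≃ₗ[𝕎]
        (𝕎 ⧸ Ideal.span {(2 : 𝕎)}))) := by
  classical
  refine ⟨?_, ?_, ?_⟩
  · have e := (Rep.FiniteCyclicGroup.groupCohomologyIso₀ (Rep.of ρ) _ aux_gen).toLinearEquiv
    have key : ∀ z : LinearMap.ker (Rep.applyAsHom (Rep.of ρ)
        (Multiplicative.ofAdd (1 : ZMod 4)) - CategoryTheory.CategoryStruct.id _).hom.toLinearMap,
        z.1 = 0 := fun z => aux_ker k ρ hρ _ (sub_eq_zero.1 z.2)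
    exact ⟨fun x y => e.injective (Subtype.ext ((key (e x)).trans (key (e y)).symm))⟩
  · intro s hs he
    have : NeZero s := ⟨hs.ne'⟩
    have hsurj : Function.Surjective
        (Rep.FiniteCyclicGroup.groupCohomologyπEven (Rep.of ρ) _ aux_gen s he) :=
      (ModuleCat.epi_iff_surjective _).1 (CategoryTheory.epi_comp'
        (@CategoryTheory.IsIso.epi_of_iso _ _ _ _ _ (CategoryTheory.Iso.isIso_inv _))
        (CategoryTheory.epi_comp' inferInstance inferInstance))
    have key : ∀ z : LinearMap.ker (Rep.applyAsHom (Rep.of ρ)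
        (Multiplicative.ofAdd (1 : ZMod 4)) - CategoryTheory.CategoryStruct.id _).hom.toLinearMap,
        z = 0 := fun z => Subtype.ext (aux_ker k ρ hρ _ (sub_eq_zero.1 z.2))
    refine ⟨fun x y => ?_⟩
    obtain ⟨x, rfl⟩ := hsurj x
    obtain ⟨y, rfl⟩ := hsurj y
    rw [key x, key y]
  · intro s hs
    have hsurj : Function.Surjective
        (Rep.FiniteCyclicGroup.groupCohomologyπOdd (Rep.of ρ) _ aux_gen s hs) :=
      (ModuleCat.epi_iff_surjective _).1 (CategoryTheory.epi_comp'
        (@CategoryTheory.IsIso.epi_of_iso _ _ _ _ _ (CategoryTheory.Iso.isIso_inv _))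
        (CategoryTheory.epi_comp' inferInstance inferInstance))
    let K := LinearMap.ker (Rep.norm (Rep.of ρ)).hom.toLinearMap
    let p : K →ₗ[𝕎] groupCohomology (Rep.of ρ) s :=
      (Rep.FiniteCyclicGroup.groupCohomologyπOdd (Rep.of ρ) _ aux_gen s hs).hom
    let q : K →ₗ[𝕎] (𝕎 ⧸ Ideal.span {(2 : 𝕎)}) := (auxMap k) ∘ₗ K.subtype
    have hq : Function.Surjective q := by
      intro c
      obtain ⟨v, hv⟩ := auxMap_surj k c
      exact ⟨⟨v, aux_norm k ρ hρ v⟩, hv⟩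
    have hker : LinearMap.ker p = LinearMap.ker q := by
      ext x
      exact (Rep.FiniteCyclicGroup.groupCohomologyπOdd_eq_zero_iff (Rep.of ρ) _ aux_gen s hs x).trans
        (auxMap_eq_zero k ρ hρ x.1).symm
    exact ⟨(p.quotKerEquivOfSurjective hsurj).symm ≪≫ₗ
      Submodule.quotEquivOfEq _ _ hker ≪≫ₗ q.quotKerEquivOfSurjective hq⟩
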